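/- (Expected local-GAAP demographic profit equals the released implicit safety loading.) Let v_t, v_{t+1}, π, j*, q* ∈ ℝ satisfy the first-order reserve recursion (v_t + π)·(1 + j*) = q* + (1 − q*)·v_{t+1}, and let q ∈ ℝ be the second-order one-year death probability. Let (Ω, F, μ) be a probability space and W, S, Z integrable real-valued random variables with E[Z] = q·E[W − S], and set W' = W − S − Z. Then the local-GAAP demographic profit Y_LG = (v_t + π)·(W − S)·(1 + j*) − (Z + W'·v_{t+1}) satisfies E[Y_LG] = (1 − v_{t+1})·(q* − q)·E[W − S]. -/

import Mathlib

open MeasureTheory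

/-- The expected local-GAAP demographic profit equals the released implicit
safety loading: given the first-order reserve recursion
`(v_t + π)·(1 + j*) = q* + (1 − q*)·v_{t+1}` and `E[Z] = q·E[W − S]`, the
local-GAAP demographic profit satisfies
`E[Y_LG] = (1 − v_{t+1})·(q* − q)·E[W − S]`. -/
theorem expected_localGAAP_profit
    (v_t v_t1 π jstar qstar : ℝ)
    (hrec : (v_t + π) * (1 + jstar) = qstar + (1 - qstar) * v_t1)
    (q : ℝ)
    {Ω : Type*} [MeasurableSpace Ω] (μ : Measure Ω) [IsProbabilityMeasure μ]
    (W S Z : Ω → ℝ) (hW : Integrable W μ) (hS : Integrable S μ)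
    (hZ : Integrable Z μ)
    (hEZ : ∫ ω, Z ω ∂μ = q * ∫ ω, (W ω - S ω) ∂μ)
    (W' : Ω → ℝ) (hW' : ∀ ω, W' ω = W ω - S ω - Z ω)
    (Y_LG : Ω → ℝ)
    (hLG : ∀ ω, Y_LG ω
      = (v_t + π) * (W ω - S ω) * (1 + jstar) - (Z ω + W' ω * v_t1)) :
    ∫ ω, Y_LG ω ∂μ = (1 - v_t1) * (qstar - q) * ∫ ω, (W ω - S ω) ∂μ := by
  have hY : ∀ ω, Y_LG ω = (1 - v_t1) * qstar * (W ω - S ω) - (1 - v_t1) * Z ω := by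
    intro ω
    rw [hLG, hW']
    linear_combination (W ω - S ω) * hrec
  have hWS : Integrable (fun ω => W ω - S ω) μ := hW.sub hS
  simp_rw [hY]
  rw [integral_sub (hWS.const_mul _) (hZ.const_mul _), integral_const_mul,
    integral_const_mul, hEZ]
  ring
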